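/- Fix δ > 0. As n → ∞, the maximal number of vertices of an element of Π̃_{n,n+δ}, i.e. max{ card(supp ν) : ν ∈ Π̃_{n,n+δ} }, is asymptotically equivalent to (3/(2·π^{1/3}))·n^{2/3}. -/

import Mathlib

open Real Filter Asymptotics

/-- The set of pairs of coprime nonnegative integers (including `(0,1)` and `(1,0)`). -/
abbrev Xc : Type := {x : ℕ × ℕ // Nat.gcd x.1 x.2 = 1}

/-- The total length `∑_{x∈X} ν(x)·√(x₁²+x₂²)` of the chain encoded by `ν`. -/
noncomputable def totalLength (ν : Xc →₀ ℕ) : ℝ :=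
  ν.sum fun x m => (m : ℝ) * Real.sqrt ((x.val.1 : ℝ) ^ 2 + (x.val.2 : ℝ) ^ 2)

/-- The maximal number of vertices of an element of `Π̃_{n,n+δ}`. -/
noncomputable def maxVerticesLen (n : ℕ) (δ : ℝ) : ℕ :=
  sSup {k : ℕ | ∃ ν : Xc →₀ ℕ,
    totalLength ν ∈ Set.Icc (n : ℝ) ((n : ℝ) + δ) ∧ ν.support.card = k}

section

open Topology Finset MeasureTheory

lemma sum_moebius_divisors_gcd (m : ℕ) :
    ∑ d ∈ m.divisors, (ArithmeticFunction.moebius d : ℝ) = if m = 1 then 1 else 0 := by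
  have h := congrArg (fun f : ArithmeticFunction ℤ => f m) ArithmeticFunction.moebius_mul_coe_zeta
  simp only [ArithmeticFunction.coe_mul_zeta_apply, ArithmeticFunction.one_apply] at h
  exact_mod_cast h

lemma tsum_moebius_div_sq :
    ∑' d : ℕ, (ArithmeticFunction.moebius d : ℝ) / (d : ℝ) ^ 2 = 6 / π ^ 2 := by
  have h := ArithmeticFunction.LSeries_zeta_mul_Lseries_moebius (s := 2) (by norm_num)
  rw [ArithmeticFunction.LSeries_zeta_eq_riemannZeta (by norm_num), riemannZeta_two] at h
  have h2 : LSeries (fun n => ((ArithmeticFunction.moebius n : ℤ) : ℂ)) 2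
      = ((∑' d : ℕ, (ArithmeticFunction.moebius d : ℝ) / (d : ℝ) ^ 2 : ℝ) : ℂ) := by
    rw [LSeries, Complex.ofReal_tsum]
    congr 1
    ext d
    rcases eq_or_ne d 0 with rfl | hd
    · simp
    · rw [LSeries.term_of_ne_zero hd]
      push_cast
      norm_cast
  rw [h2] at h
  have h3 : (π ^ 2 / 6) * (∑' d : ℕ, (ArithmeticFunction.moebius d : ℝ) / (d : ℝ) ^ 2) = 1 := by
    exact_mod_cast h
  have := pi_pos
  field_simp at h3 ⊢
  linarith

/-- The group `ℤ + ℤ√2` has arbitrarily small positive elements. -/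
lemma exists_int_combination_sqrt_two {δ : ℝ} (hδ : 0 < δ) :
    ∃ p q : ℤ, 0 < p + q * √2 ∧ p + q * √2 < δ := by
  have h1 : (1 : ℝ) < √2 := by rw [Real.lt_sqrt] <;> norm_num
  have h2 : √2 < 2 := by rw [Real.sqrt_lt'] <;> norm_num
  obtain ⟨k, hk⟩ := exists_pow_lt_of_lt_one hδ (show √2 - 1 < 1 by linarith)
  have hrep : ∀ k : ℕ, ∃ p q : ℤ, (√2 - 1) ^ k = p + q * √2 := by
    intro k
    induction k with
    | zero => exact ⟨1, 0, by simp⟩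
    | succ k ih =>
      obtain ⟨p, q, h⟩ := ih
      refine ⟨2 * q - p, p - q, ?_⟩
      rw [pow_succ, h]
      push_cast
      linear_combination (q : ℝ) * Real.sq_sqrt (show (0 : ℝ) ≤ 2 by norm_num)
  obtain ⟨p, q, h⟩ := hrep k
  exact ⟨p, q, h ▸ pow_pos (by linarith) k, h ▸ hk⟩

lemma exists_nat_combination_sqrt_two {δ : ℝ} (hδ : 0 < δ) :
    ∃ C : ℝ, ∀ x : ℝ, C ≤ x → ∃ a b : ℕ, x ≤ a + b * √2 ∧ a + b * √2 ≤ x + δ := by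
  obtain ⟨p, q, h0, h1⟩ := exists_int_combination_sqrt_two hδ
  set θ := p + q * √2 with hθ
  set K := ⌈1 / θ⌉₊
  set B : ℕ := K * q.natAbs
  refine ⟨B * √2 + 1 + K * p.natAbs, fun x hx => ?_⟩
  set a := ⌊x - B * √2⌋
  have ha1 : (a : ℝ) ≤ x - B * √2 := Int.floor_le _
  have ha2 : x - B * √2 < a + 1 := Int.lt_floor_add_one _
  set y := x - B * √2 - a
  set j := ⌈y / θ⌉₊
  have hy0 : 0 ≤ y := by simp only [y]; linarith
  have hjK : j ≤ K := Nat.ceil_mono (by gcongr; simp only [y]; linarith)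
  have hj1 : y ≤ j * θ := (div_le_iff₀ h0).1 (Nat.le_ceil _)
  have hj2 : j * θ < y + θ := by
    have := (Nat.ceil_lt_add_one (div_nonneg hy0 h0.le))
    calc j * θ < (y / θ + 1) * θ := by gcongr
      _ = y + θ := by field_simp
  have hB : 0 ≤ (B : ℤ) + j * q := by
    have : (j : ℤ) * |q| ≤ K * |q| := by gcongr
    have h3 : -(j * |q|) ≤ (j : ℤ) * q := by nlinarith [neg_abs_le q]
    simp only [B]; push_cast; linarith
  have hA : 0 ≤ a + j * p := by
    have : (j : ℤ) * |p| ≤ K * |p| := by gcongr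
    have h3 : -(j * |p|) ≤ (j : ℤ) * p := by nlinarith [neg_abs_le p]
    have h4 : (K : ℝ) * (p.natAbs : ℕ) ≤ a := by linarith
    have h5 : (((K * p.natAbs : ℕ) : ℤ) : ℝ) ≤ a := by rw [Int.cast_natCast, Nat.cast_mul]; exact h4
    have h6 := Int.cast_le.1 h5
    push_cast at h6
    linarith
  refine ⟨(a + j * p).toNat, ((B : ℤ) + j * q).toNat, ?_⟩
  have e1 : (((a + j * p).toNat : ℕ) : ℝ) = a + j * p := by
    have := Int.toNat_of_nonneg hA
    exact_mod_cast congrArg (Int.cast (R := ℝ)) this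
  have e2 : ((((B : ℤ) + j * q).toNat : ℕ) : ℝ) = B + j * q := by
    have := Int.toNat_of_nonneg hB
    exact_mod_cast congrArg (Int.cast (R := ℝ)) this
  have e3 : (a + j * p : ℝ) + (B + j * q) * √2 = x + (j * θ - y) := by
    simp only [hθ, y]; ring
  rw [e1, e2, e3]
  constructor <;> linarith

/-- Euclidean norm of a pair of natural numbers. -/
noncomputable def pairNorm (y : ℕ × ℕ) : ℝ := √((y.1 : ℝ) ^ 2 + (y.2 : ℝ) ^ 2)

lemma pairNorm_nonneg (y : ℕ × ℕ) : 0 ≤ pairNorm y := Real.sqrt_nonneg _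

lemma fst_le_pairNorm (y : ℕ × ℕ) : (y.1 : ℝ) ≤ pairNorm y :=
  Real.le_sqrt_of_sq_le (by nlinarith [sq_nonneg (y.2 : ℝ)])

lemma snd_le_pairNorm (y : ℕ × ℕ) : (y.2 : ℝ) ≤ pairNorm y :=
  Real.le_sqrt_of_sq_le (by nlinarith [sq_nonneg (y.1 : ℝ)])

lemma pairNorm_nsmul (d : ℕ) (y : ℕ × ℕ) : pairNorm (d * y.1, d * y.2) = d * pairNorm y := by
  simp only [pairNorm]
  conv_rhs => rw [← Real.sqrt_sq (Nat.cast_nonneg (α := ℝ) d), ← Real.sqrt_mul (sq_nonneg _)]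
  congr 1
  push_cast
  ring

/-- Nonzero pairs of natural numbers of norm at most `r`. -/
noncomputable def latticeBall (r : ℝ) : Finset (ℕ × ℕ) :=
  (range (⌊r⌋₊ + 1) ×ˢ range (⌊r⌋₊ + 1)).filter fun y => y ≠ 0 ∧ pairNorm y ≤ r

lemma mem_latticeBall {r : ℝ} {y : ℕ × ℕ} : y ∈ latticeBall r ↔ y ≠ 0 ∧ pairNorm y ≤ r := by
  simp only [latticeBall, mem_filter, mem_product, mem_range, and_iff_right_iff_imp, Nat.lt_succ_iff]
  exact fun h => ⟨Nat.le_floor ((fst_le_pairNorm y).trans h.2),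
    Nat.le_floor ((snd_le_pairNorm y).trans h.2)⟩

/-- Pairs of coprime natural numbers of norm at most `r`. -/
noncomputable def primitiveBall (r : ℝ) : Finset (ℕ × ℕ) :=
  (latticeBall r).filter fun y => y.1.gcd y.2 = 1

lemma mem_primitiveBall {r : ℝ} {y : ℕ × ℕ} :
    y ∈ primitiveBall r ↔ y.1.gcd y.2 = 1 ∧ pairNorm y ≤ r := by
  simp only [primitiveBall, mem_filter, mem_latticeBall]
  refine ⟨fun h => ⟨h.2, h.1.2⟩, fun h => ⟨⟨?_, h.2⟩, h.1⟩⟩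
  rintro rfl
  simp at h

lemma one_le_pairNorm {y : ℕ × ℕ} (hy : y ≠ 0) : 1 ≤ pairNorm y := by
  by_cases h : y.1 = 0
  · have : y.2 ≠ 0 := fun h' => hy (Prod.ext h h')
    exact le_trans (by exact_mod_cast Nat.one_le_iff_ne_zero.2 this) (snd_le_pairNorm y)
  · exact le_trans (by exact_mod_cast Nat.one_le_iff_ne_zero.2 h) (fst_le_pairNorm y)

lemma latticeBall_eq_empty {r : ℝ} (hr : r < 1) : latticeBall r = ∅ := by
  ext y
  simp only [mem_latticeBall, notMem_empty, iff_false]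
  exact fun h => by linarith [one_le_pairNorm h.1]

lemma card_filter_dvd_gcd (r : ℝ) {d : ℕ} (hd : d ≠ 0) :
    ((latticeBall r).filter fun y => d ∣ y.1.gcd y.2).card = (latticeBall (r / d)).card := by
  have hd' : (0 : ℝ) < d := by positivity
  symm
  refine card_bij (fun y _ => (d * y.1, d * y.2)) ?_ ?_ ?_
  · intro y hy
    rw [mem_latticeBall] at hy
    rw [mem_filter, mem_latticeBall, pairNorm_nsmul, Nat.gcd_mul_left]
    refine ⟨⟨?_, by rw [mul_comm]; exact (le_div_iff₀ hd').1 hy.2⟩, dvd_mul_right _ _⟩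
    intro h
    apply hy.1
    simpa [Prod.ext_iff, hd] using h
  · intro y _ z _ h
    simpa [Prod.ext_iff, hd] using h
  · intro z hz
    rw [mem_filter, mem_latticeBall] at hz
    obtain ⟨⟨h0, hr⟩, hdvd⟩ := hz
    obtain ⟨u, hu⟩ := hdvd.trans (Nat.gcd_dvd_left _ _)
    obtain ⟨v, hv⟩ := hdvd.trans (Nat.gcd_dvd_right _ _)
    have hz : z = (d * (u, v).1, d * (u, v).2) := Prod.ext hu hv
    refine ⟨(u, v), ?_, hz.symm⟩
    rw [mem_latticeBall]
    constructor
    · intro h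
      apply h0
      rw [hz, h]
      simp
    · rw [hz, pairNorm_nsmul] at hr
      rw [le_div_iff₀ hd', mul_comm]
      exact hr

lemma card_primitiveBall_eq_tsum (r : ℝ) :
    ((primitiveBall r).card : ℝ)
      = ∑' d : ℕ, (ArithmeticFunction.moebius d : ℝ) * (latticeBall (r / d)).card := by
  rw [tsum_eq_sum (s := Icc 1 ⌊r⌋₊)]
  · have h1 : ((primitiveBall r).card : ℝ)
        = ∑ y ∈ latticeBall r, ∑ d ∈ (y.1.gcd y.2).divisors, (ArithmeticFunction.moebius d : ℝ) := by
      simp_rw [sum_moebius_divisors_gcd]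
      simp [primitiveBall]
    have h2 : ∀ y ∈ latticeBall r,
        ∑ d ∈ (y.1.gcd y.2).divisors, (ArithmeticFunction.moebius d : ℝ)
        = ∑ d ∈ Icc 1 ⌊r⌋₊, if d ∣ y.1.gcd y.2 then (ArithmeticFunction.moebius d : ℝ) else 0 := by
      intro y hy
      rw [mem_latticeBall] at hy
      rw [← sum_filter]
      congr 1
      ext d
      simp only [Nat.mem_divisors, mem_filter, mem_Icc]
      have hg : y.1.gcd y.2 ≠ 0 := fun h => hy.1 (Prod.ext (Nat.gcd_eq_zero_iff.1 h).1
        (Nat.gcd_eq_zero_iff.1 h).2)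
      refine ⟨fun h => ⟨⟨Nat.pos_of_dvd_of_pos h.1 (Nat.pos_of_ne_zero hg), ?_⟩, h.1⟩,
        fun h => ⟨h.2, hg⟩⟩
      apply Nat.le_floor
      by_cases h0 : y.1 = 0
      · have : y.2 ≠ 0 := fun h' => hy.1 (Prod.ext h0 h')
        have := Nat.le_of_dvd (Nat.pos_of_ne_zero this) (h.1.trans (Nat.gcd_dvd_right _ _))
        exact (Nat.cast_le.2 this).trans ((snd_le_pairNorm y).trans hy.2)
      · have := Nat.le_of_dvd (Nat.pos_of_ne_zero h0) (h.1.trans (Nat.gcd_dvd_left _ _))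
        exact (Nat.cast_le.2 this).trans ((fst_le_pairNorm y).trans hy.2)
    rw [h1, sum_congr rfl h2, sum_comm]
    refine sum_congr rfl fun d hd => ?_
    rw [← card_filter_dvd_gcd r (by have := (mem_Icc.1 hd).1; omega), ← sum_filter, sum_const,
      nsmul_eq_mul, mul_comm]
  · intro d hd
    rcases eq_or_ne d 0 with rfl | h0
    · simp
    · have h1 : r / d < 1 := by
        rw [div_lt_one (by positivity)]
        by_contra! h
        exact hd (mem_Icc.2 ⟨Nat.one_le_iff_ne_zero.2 h0, Nat.le_floor h⟩)
      rw [latticeBall_eq_empty h1]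
      simp

lemma integral_sqrt_sq_sub_sq {t M : ℝ} (ht : 0 < t) (hM : t ≤ M) :
    ∫ x in (0 : ℝ)..M, √(t ^ 2 - x ^ 2) = π / 4 * t ^ 2 := by
  have hint : ∀ a b : ℝ, IntervalIntegrable (fun x => √(1 - x ^ 2)) volume a b := fun a b =>
    (by fun_prop : Continuous fun x : ℝ => √(1 - x ^ 2)).intervalIntegrable a b
  have h1 : ∫ x in (0 : ℝ)..1, √(1 - x ^ 2) = π / 4 := by
    have h := integral_sqrt_one_sub_sq
    rw [← intervalIntegral.integral_add_adjacent_intervals (hint (-1) 0) (hint 0 1)] at h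
    have h' := intervalIntegral.integral_comp_neg (a := 0) (b := 1) (fun x : ℝ => √(1 - x ^ 2))
    simp only [even_two, Even.neg_pow, neg_zero] at h'
    linarith
  have h2 : ∫ x in (1 : ℝ)..(M / t), √(1 - x ^ 2) = 0 := by
    apply intervalIntegral.integral_zero_ae
    refine ae_of_all _ fun x hx => Real.sqrt_eq_zero_of_nonpos ?_
    rw [Set.uIoc_of_le ((one_le_div ht).2 hM)] at hx
    nlinarith [hx.1]
  have h3 : ∀ x, √(t ^ 2 - x ^ 2) = t * √(1 - (x / t) ^ 2) := by
    intro x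
    rw [← Real.sqrt_sq ht.le, ← Real.sqrt_mul (sq_nonneg _), Real.sqrt_sq ht.le]
    congr 1
    field_simp
  simp_rw [h3]
  rw [intervalIntegral.integral_const_mul,
    intervalIntegral.integral_comp_div (fun x : ℝ => √(1 - x ^ 2)) ht.ne', zero_div,
    ← intervalIntegral.integral_add_adjacent_intervals (hint 0 1) (hint 1 _), h1, h2, smul_eq_mul]
  ring

lemma card_latticeBall_add_one {t : ℝ} (ht : 0 < t) :
    (latticeBall t).card + 1 = ∑ a ∈ range (⌊t⌋₊ + 1), (⌊√(t ^ 2 - (a : ℝ) ^ 2)⌋₊ + 1) := by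
  have h0 : (0 : ℕ × ℕ) ∉ latticeBall t := by simp [mem_latticeBall]
  rw [← card_insert_of_notMem h0]
  have : insert 0 (latticeBall t) = (range (⌊t⌋₊ + 1)).biUnion fun a =>
      (range (⌊√(t ^ 2 - (a : ℝ) ^ 2)⌋₊ + 1)).image fun b => (a, b) := by
    ext ⟨a, b⟩
    have key : pairNorm (a, b) ≤ t ↔ a < ⌊t⌋₊ + 1 ∧ b < ⌊√(t ^ 2 - (a : ℝ) ^ 2)⌋₊ + 1 := by
      rw [Nat.lt_succ_iff, Nat.lt_succ_iff, Nat.le_floor_iff ht.le,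
        Nat.le_floor_iff (Real.sqrt_nonneg _)]
      constructor
      · intro h
        refine ⟨(fst_le_pairNorm (a, b)).trans h, Real.le_sqrt_of_sq_le ?_⟩
        rw [pairNorm, Real.sqrt_le_left ht.le] at h
        linarith
      · rintro ⟨h, h'⟩
        rw [pairNorm, Real.sqrt_le_left ht.le]
        have : (b : ℝ) ^ 2 ≤ t ^ 2 - (a : ℝ) ^ 2 := by
          rwa [Real.le_sqrt (by positivity) (by nlinarith [Nat.cast_nonneg (α := ℝ) a])] at h'
        simp only
        linarith
    have h00 : pairNorm 0 ≤ t := by simpa [pairNorm] using ht.le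
    simp only [mem_insert, mem_latticeBall, mem_biUnion, mem_image, mem_range, Prod.mk.injEq]
    constructor
    · intro h
      have h' : pairNorm (a, b) ≤ t := by
        rcases h with h | h
        · rw [h]; exact h00
        · exact h.2
      exact ⟨a, (key.1 h').1, b, (key.1 h').2, rfl, rfl⟩
    · rintro ⟨a', ha, b', hb, rfl, rfl⟩
      by_cases h : ((a', b') : ℕ × ℕ) = 0
      · exact Or.inl h
      · exact Or.inr ⟨h, key.2 ⟨ha, hb⟩⟩
  rw [this, card_biUnion]
  · refine sum_congr rfl fun a _ => ?_
    rw [card_image_of_injective _ (Prod.mk_right_injective a), card_range]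
  · intro a _ a' _ haa
    rw [Function.onFun, disjoint_left]
    intro z hz hz'
    simp only [mem_image] at hz hz'
    obtain ⟨b, _, rfl⟩ := hz
    obtain ⟨b', _, h⟩ := hz'
    exact haa (Prod.ext_iff.1 h).1.symm

lemma card_latticeBall_bounds {t : ℝ} (ht : 0 < t) :
    π / 4 * t ^ 2 - 1 ≤ (latticeBall t).card ∧
      ((latticeBall t).card : ℝ) ≤ π / 4 * t ^ 2 + 2 * t := by
  set f : ℝ → ℝ := fun x => √(t ^ 2 - x ^ 2) with hf
  set M := ⌊t⌋₊ + 1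
  have hanti : AntitoneOn f (Set.Icc 0 (0 + (M : ℝ))) := by
    intro x hx y hy hxy
    apply Real.sqrt_le_sqrt
    have := hx.1
    gcongr
  have hI : ∫ x in (0 : ℝ)..0 + M, f x = π / 4 * t ^ 2 := by
    rw [zero_add]
    apply integral_sqrt_sq_sub_sq ht
    simpa [M] using (Nat.lt_floor_add_one t).le
  have h1 := hanti.integral_le_sum
  have h2 := hanti.sum_le_integral
  rw [hI] at h1 h2
  simp only [zero_add] at h1 h2
  have hcard := card_latticeBall_add_one ht
  have hcard' : ((latticeBall t).card : ℝ) + 1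
      = ∑ a ∈ range M, ((⌊f a⌋₊ : ℝ) + 1) := by
    simpa using congrArg (Nat.cast (R := ℝ)) hcard
  constructor
  · have : ∑ a ∈ range M, f a ≤ ∑ a ∈ range M, ((⌊f a⌋₊ : ℝ) + 1) :=
      sum_le_sum fun a _ => (Nat.lt_floor_add_one _).le
    linarith
  · have h3 : ∑ a ∈ range M, ((⌊f a⌋₊ : ℝ) + 1) ≤ ∑ a ∈ range M, (f a + 1) :=
      sum_le_sum fun a _ => by gcongr; exact Nat.floor_le (Real.sqrt_nonneg _)
    have h4 : ∑ a ∈ range M, f a ≤ f 0 + ∑ i ∈ range M, f ((i + 1 : ℕ) : ℝ) := by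
      have e : ∑ a ∈ range (M + 1), f a = ∑ i ∈ range M, f ((i + 1 : ℕ) : ℝ) + f ((0 : ℕ) : ℝ) :=
        sum_range_succ' (fun a : ℕ => f a) M
      rw [sum_range_succ, Nat.cast_zero] at e
      have : 0 ≤ f M := Real.sqrt_nonneg _
      linarith
    have h5 : f 0 = t := by simp [hf, Real.sqrt_sq ht.le]
    have h6 : (M : ℝ) ≤ t + 1 := by simpa [M] using Nat.floor_le ht.le
    rw [sum_add_distrib (f := fun a : ℕ => f a), sum_const, card_range, nsmul_eq_mul, mul_one] at h3
    linarith

lemma card_latticeBall_le {t : ℝ} (ht : 0 ≤ t) : ((latticeBall t).card : ℝ) ≤ 3 * t ^ 2 := by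
  rcases lt_or_ge t 1 with h | h
  · rw [latticeBall_eq_empty h]
    simpa using sq_nonneg t
  · have := (card_latticeBall_bounds (by linarith)).2
    nlinarith [pi_lt_four]

lemma tendsto_card_latticeBall :
    Tendsto (fun t : ℝ => ((latticeBall t).card : ℝ) / t ^ 2) atTop (𝓝 (π / 4)) := by
  have hinv : Tendsto (fun t : ℝ => t⁻¹) atTop (𝓝 0) := tendsto_inv_atTop_zero
  have hl : Tendsto (fun t : ℝ => π / 4 - t⁻¹ ^ 2) atTop (𝓝 (π / 4)) := by
    simpa using (hinv.pow 2).const_sub (π / 4)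
  have hu : Tendsto (fun t : ℝ => π / 4 + 2 * t⁻¹) atTop (𝓝 (π / 4)) := by
    simpa using (hinv.const_mul 2).const_add (π / 4)
  refine tendsto_of_tendsto_of_tendsto_of_le_of_le' hl hu ?_ ?_
  · filter_upwards [eventually_gt_atTop 0] with t ht
    rw [le_div_iff₀ (by positivity)]
    calc _ = π / 4 * t ^ 2 - 1 := by field_simp
      _ ≤ _ := (card_latticeBall_bounds ht).1
  · filter_upwards [eventually_gt_atTop 0] with t ht
    rw [div_le_iff₀ (by positivity)]
    calc _ ≤ _ := (card_latticeBall_bounds ht).2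
      _ = _ := by field_simp

lemma tendsto_card_primitiveBall :
    Tendsto (fun r : ℝ => ((primitiveBall r).card : ℝ) / r ^ 2) atTop (𝓝 (3 / (2 * π))) := by
  have hlim : 3 / (2 * π) = ∑' d : ℕ, (ArithmeticFunction.moebius d : ℝ) / (d : ℝ) ^ 2 * (π / 4) := by
    rw [tsum_mul_right, tsum_moebius_div_sq]
    field_simp
    norm_num
  simp_rw [card_primitiveBall_eq_tsum, ← tsum_div_const]
  rw [hlim]
  refine tendsto_tsum_of_dominated_convergence (bound := fun d : ℕ => 3 * (1 / (d : ℝ) ^ 2))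
    ((Real.summable_one_div_nat_pow.2 one_lt_two).mul_left 3) ?_ ?_
  · intro d
    rcases eq_or_ne d 0 with rfl | hd
    · simp
    · have hd' : (0 : ℝ) < d := by positivity
      have h := tendsto_card_latticeBall.comp (tendsto_id.atTop_div_const hd')
      refine (h.const_mul ((ArithmeticFunction.moebius d : ℝ) / (d : ℝ) ^ 2)).congr fun r => ?_
      simp only [Function.comp, id]
      rw [div_pow]
      field_simp
  · filter_upwards [eventually_gt_atTop 0] with r hr d
    rw [norm_div, norm_mul, norm_pow, Real.norm_of_nonneg hr.le, div_le_iff₀ (by positivity),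
      Real.norm_natCast]
    have h1 : ‖(ArithmeticFunction.moebius d : ℝ)‖ ≤ 1 := by
      rcases ArithmeticFunction.moebius_eq_or d with h | h | h <;> simp [h]
    calc _ ≤ 1 * (3 * (r / d) ^ 2) := by
          gcongr
          exact card_latticeBall_le (by positivity)
      _ = _ := by ring

lemma primitiveBall_mono : Monotone primitiveBall := fun _ _ hst _ hy =>
  mem_primitiveBall.2 ⟨(mem_primitiveBall.1 hy).1, (mem_primitiveBall.1 hy).2.trans hst⟩

lemma card_primitiveBall_mono : Monotone fun t => ((primitiveBall t).card : ℝ) := fun _ _ hst =>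
  Nat.cast_le.2 (card_le_card (primitiveBall_mono hst))

/-- Total deficit `∑ (r - |x|)` over primitive vectors `x` of norm at most `r`. -/
noncomputable def primitiveDeficit (r : ℝ) : ℝ := ∑ x ∈ primitiveBall r, (r - pairNorm x)

lemma primitiveDeficit_eq_integral {r : ℝ} (hr : 0 ≤ r) :
    primitiveDeficit r = ∫ t in (0 : ℝ)..r, ((primitiveBall t).card : ℝ) := by
  have hmono : ∀ l : ℝ, Monotone fun t => (Set.Ici l).indicator (fun _ => (1 : ℝ)) t := by
    intro l s t hst
    simp only [Set.indicator_apply, Set.mem_Ici]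
    split_ifs <;> linarith
  have hN : ∀ t ∈ Set.uIcc 0 r, ((primitiveBall t).card : ℝ)
      = ∑ x ∈ primitiveBall r, (Set.Ici (pairNorm x)).indicator (fun _ => (1 : ℝ)) t := by
    intro t ht
    rw [Set.uIcc_of_le hr] at ht
    have : primitiveBall t = (primitiveBall r).filter fun x => pairNorm x ≤ t := by
      ext x
      simp only [mem_primitiveBall, mem_filter]
      exact ⟨fun h => ⟨⟨h.1, h.2.trans ht.2⟩, h.2⟩, fun h => ⟨h.1.1, h.2⟩⟩
    rw [this]
    simp [Set.indicator_apply]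
  rw [intervalIntegral.integral_congr hN,
    intervalIntegral.integral_finsetSum fun x _ => (hmono _).intervalIntegrable]
  refine sum_congr rfl fun x hx => ?_
  have hx' := mem_primitiveBall.1 hx
  have hpos : 0 < pairNorm x := by
    refine one_pos.trans_le (one_le_pairNorm ?_)
    rintro rfl
    simp at hx'
  have : Set.Ioc 0 r ∩ Set.Ici (pairNorm x) = Set.Icc (pairNorm x) r := by
    ext t
    simp only [Set.mem_inter_iff, Set.mem_Ioc, Set.mem_Ici, Set.mem_Icc]
    exact ⟨fun h => ⟨h.2, h.1.2⟩, fun h => ⟨⟨hpos.trans_le h.1, h.2⟩, h.1⟩⟩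
  rw [intervalIntegral.integral_of_le hr, setIntegral_indicator measurableSet_Ici, this]
  simp [hx'.2]

/-- Integrating a quadratic growth law gives a cubic one. -/
lemma tendsto_integral_div_cube {f : ℝ → ℝ} (hf : Monotone f) {c : ℝ}
    (h : Tendsto (fun t => f t / t ^ 2) atTop (𝓝 c)) :
    Tendsto (fun r => (∫ t in (0 : ℝ)..r, f t) / r ^ 3) atTop (𝓝 (c / 3)) := by
  have hfi : ∀ a b, IntervalIntegrable f volume a b := fun a b => hf.intervalIntegrable
  have hqi : ∀ (c K a b : ℝ), IntervalIntegrable (fun t => c * t ^ 2 + K) volume a b :=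
    fun c K a b => (by fun_prop : Continuous fun t : ℝ => c * t ^ 2 + K).intervalIntegrable a b
  have hq : ∀ c K r : ℝ, ∫ t in (0 : ℝ)..r, (c * t ^ 2 + K) = c / 3 * r ^ 3 + K * r := by
    intro c K r
    rw [intervalIntegral.integral_add, intervalIntegral.integral_const_mul, integral_pow]
    · simp; ring
    · exact (by fun_prop : Continuous fun t : ℝ => c * t ^ 2).intervalIntegrable _ _
    · exact intervalIntegrable_const
  have hlim : ∀ c K : ℝ, Tendsto (fun r : ℝ => (c / 3 * r ^ 3 + K * r) / r ^ 3) atTop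
      (𝓝 (c / 3)) := by
    intro c K
    have h0 : Tendsto (fun r : ℝ => c / 3 + K * r⁻¹ ^ 2) atTop (𝓝 (c / 3)) := by
      simpa using ((tendsto_inv_atTop_zero (𝕜 := ℝ)).pow 2 |>.const_mul K).const_add (c / 3)
    refine h0.congr' ?_
    filter_upwards [eventually_gt_atTop 0] with r hr
    field_simp
  rw [tendsto_order]
  constructor
  · intro a ha
    obtain ⟨b, hab, hbc⟩ := exists_between (show 3 * a < c by linarith)
    obtain ⟨T, hT⟩ := eventually_atTop.1 (h.eventually_const_lt hbc)
    set T' := max T 1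
    obtain ⟨K, hK⟩ : ∃ K, ∀ t, 0 ≤ t → b * t ^ 2 + K ≤ f t := by
      refine ⟨min 0 (f 0 - |b| * T' ^ 2), fun t ht => ?_⟩
      rcases le_total T' t with htT | htT
      · have h1 := hT t ((le_max_left _ _).trans htT)
        have h2 : 0 < t := by linarith [le_max_right T 1]
        rw [lt_div_iff₀ (by positivity)] at h1
        linarith [min_le_left 0 (f 0 - |b| * T' ^ 2)]
      · have h1 : b * t ^ 2 ≤ |b| * T' ^ 2 := by
          gcongr
          exact le_abs_self b
        linarith [min_le_right 0 (f 0 - |b| * T' ^ 2), hf ht]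
    filter_upwards [(hlim b K).eventually_const_lt (show a < b / 3 by linarith),
      eventually_gt_atTop 0] with r hr hr0
    refine hr.trans_le ?_
    rw [← hq b K r]
    gcongr
    exact intervalIntegral.integral_mono_on hr0.le (hqi _ _ _ _) (hfi _ _) fun t ht => hK t ht.1
  · intro a ha
    obtain ⟨b, hcb, hba⟩ := exists_between (show c < 3 * a by linarith)
    obtain ⟨T, hT⟩ := eventually_atTop.1 (h.eventually_lt_const hcb)
    set T' := max T 1
    obtain ⟨K, hK⟩ : ∃ K, ∀ t, 0 ≤ t → f t ≤ b * t ^ 2 + K := by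
      refine ⟨max 0 (f T' + |b| * T' ^ 2), fun t ht => ?_⟩
      rcases le_total T' t with htT | htT
      · have h1 := hT t ((le_max_left _ _).trans htT)
        have h2 : 0 < t := by linarith [le_max_right T 1]
        rw [div_lt_iff₀ (by positivity)] at h1
        linarith [le_max_left 0 (f T' + |b| * T' ^ 2)]
      · have h1 : -b * t ^ 2 ≤ |b| * T' ^ 2 := by
          gcongr
          exact neg_le_abs b
        linarith [le_max_right 0 (f T' + |b| * T' ^ 2), hf htT]
    filter_upwards [(hlim b K).eventually_lt_const (show b / 3 < a by linarith),
      eventually_gt_atTop 0] with r hr hr0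
    refine lt_of_le_of_lt ?_ hr
    rw [← hq b K r]
    gcongr
    exact intervalIntegral.integral_mono_on hr0.le (hfi _ _) (hqi _ _ _ _) fun t ht => hK t ht.1

lemma tendsto_primitiveDeficit :
    Tendsto (fun r => primitiveDeficit r / r ^ 3) atTop (𝓝 (1 / (2 * π))) := by
  have h := tendsto_integral_div_cube card_primitiveBall_mono tendsto_card_primitiveBall
  rw [show 3 / (2 * π) / 3 = 1 / (2 * π) by field_simp] at h
  refine h.congr' ?_
  filter_upwards [eventually_ge_atTop 0] with r hr
  rw [primitiveDeficit_eq_integral hr]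

lemma sum_pairNorm_primitiveBall (r : ℝ) :
    ∑ x ∈ primitiveBall r, pairNorm x = r * (primitiveBall r).card - primitiveDeficit r := by
  simp only [primitiveDeficit, sum_sub_distrib, sum_const, nsmul_eq_mul]
  ring

lemma tendsto_sum_pairNorm_primitiveBall :
    Tendsto (fun r => (∑ x ∈ primitiveBall r, pairNorm x) / r ^ 3) atTop (𝓝 (1 / π)) := by
  have h := tendsto_card_primitiveBall.sub tendsto_primitiveDeficit
  rw [show 3 / (2 * π) - 1 / (2 * π) = 1 / π by field_simp; norm_num] at h
  refine h.congr' ?_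
  filter_upwards [eventually_gt_atTop 0] with r hr
  rw [sum_pairNorm_primitiveBall]
  field_simp

lemma totalLength_add (ν ν' : Xc →₀ ℕ) :
    totalLength (ν + ν') = totalLength ν + totalLength ν' := by
  simp only [totalLength]
  exact Finsupp.sum_add_index' (by simp) (by intros; push_cast; ring)

lemma totalLength_single (x : Xc) (m : ℕ) :
    totalLength (Finsupp.single x m) = m * pairNorm x.val := by
  simp [totalLength, pairNorm]

lemma totalLength_eq_sum (ν : Xc →₀ ℕ) :
    totalLength ν = ∑ x ∈ ν.support, (ν x : ℝ) * pairNorm x.val := rfl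

lemma mul_card_support_le (ν : Xc →₀ ℕ) (r : ℝ) :
    r * ν.support.card ≤ totalLength ν + primitiveDeficit r := by
  have h1 : ∑ x ∈ ν.support, pairNorm x.val ≤ totalLength ν := by
    rw [totalLength_eq_sum]
    refine sum_le_sum fun x hx => le_mul_of_one_le_left (pairNorm_nonneg _) ?_
    exact_mod_cast Nat.one_le_iff_ne_zero.2 (Finsupp.mem_support_iff.1 hx)
  have h2 : ∑ x ∈ ν.support, (r - pairNorm x.val) ≤ primitiveDeficit r := by
    have e : ∑ x ∈ ν.support, (r - pairNorm x.val)
        = ∑ y ∈ ν.support.map (Function.Embedding.subtype _), (r - pairNorm y) := by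
      rw [sum_map]
      rfl
    rw [e]
    refine le_trans ?_ (sum_le_sum_of_subset_of_nonneg
      (s := (ν.support.map (Function.Embedding.subtype _)).filter fun y => pairNorm y ≤ r) ?_ ?_)
    · rw [sum_filter]
      refine sum_le_sum fun y _ => ?_
      split_ifs <;> linarith
    · intro y hy
      simp only [mem_filter, Finset.mem_map] at hy
      obtain ⟨⟨x, _, rfl⟩, hr⟩ := hy
      exact mem_primitiveBall.2 ⟨x.2, hr⟩
    · exact fun y hy _ => sub_nonneg.2 (mem_primitiveBall.1 hy).2
  rw [sum_sub_distrib, sum_const, nsmul_eq_mul] at h2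
  linarith

lemma card_support_le (ν : Xc →₀ ℕ) {r A : ℝ} (hr : 0 < r) (hν : totalLength ν ≤ A) :
    (ν.support.card : ℝ) ≤ (A + primitiveDeficit r) / r := by
  rw [le_div_iff₀ hr]
  linarith [mul_card_support_le ν r]

lemma bddAbove_card_support (n : ℕ) (δ : ℝ) :
    BddAbove {k : ℕ | ∃ ν : Xc →₀ ℕ,
      totalLength ν ∈ Set.Icc (n : ℝ) ((n : ℝ) + δ) ∧ ν.support.card = k} := by
  refine ⟨⌊((n : ℝ) + δ + primitiveDeficit 1) / 1⌋₊, ?_⟩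
  rintro k ⟨ν, hν, rfl⟩
  exact Nat.le_floor (card_support_le ν one_pos hν.2)

lemma maxVerticesLen_le (n : ℕ) {δ r : ℝ} (hδ : 0 ≤ δ) (hr : 0 < r) :
    (maxVerticesLen n δ : ℝ) ≤ (n + δ + primitiveDeficit r) / r := by
  have hne : {k : ℕ | ∃ ν : Xc →₀ ℕ,
      totalLength ν ∈ Set.Icc (n : ℝ) ((n : ℝ) + δ) ∧ ν.support.card = k}.Nonempty := by
    refine ⟨_, Finsupp.single ⟨(1, 0), by simp⟩ n, ?_, rfl⟩
    rw [totalLength_single]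
    simpa [pairNorm] using hδ
  obtain ⟨ν, hν, hk⟩ := Nat.sSup_mem hne (bddAbove_card_support n δ)
  rw [maxVerticesLen, ← hk]
  exact card_support_le ν hr hν.2

/-- The chain using each primitive vector of norm at most `r` exactly once. -/
noncomputable def primitiveChain (r : ℝ) : Xc →₀ ℕ :=
  Finsupp.indicator ((primitiveBall r).subtype fun x => Nat.gcd x.1 x.2 = 1) fun _ _ => 1

lemma primitiveChain_support (r : ℝ) :
    (primitiveChain r).support = (primitiveBall r).subtype fun x => Nat.gcd x.1 x.2 = 1 := by
  ext x
  simp [primitiveChain, Finsupp.indicator_apply]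

lemma card_primitiveChain_support (r : ℝ) :
    (primitiveChain r).support.card = (primitiveBall r).card := by
  rw [primitiveChain_support, card_subtype, filter_true_of_mem]
  exact fun x hx => (mem_primitiveBall.1 hx).1

lemma totalLength_primitiveChain (r : ℝ) :
    totalLength (primitiveChain r) = ∑ x ∈ primitiveBall r, pairNorm x := by
  rw [totalLength_eq_sum, primitiveChain_support,
    ← sum_subtype_of_mem pairNorm fun x hx => (mem_primitiveBall.1 hx).1]
  refine sum_congr rfl fun x hx => ?_
  rw [primitiveChain, Finsupp.indicator_of_mem hx]
  simp

lemma card_primitiveBall_le_maxVerticesLen {δ : ℝ} (hδ : 0 < δ) :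
    ∃ C : ℝ, ∀ (n : ℕ) (r : ℝ), (∑ x ∈ primitiveBall r, pairNorm x) + C ≤ n →
      (primitiveBall r).card ≤ maxVerticesLen n δ := by
  obtain ⟨C, hC⟩ := exists_nat_combination_sqrt_two hδ
  refine ⟨C, fun n r h => ?_⟩
  obtain ⟨a, b, h1, h2⟩ := hC (n - ∑ x ∈ primitiveBall r, pairNorm x) (by linarith)
  set μ : Xc →₀ ℕ := Finsupp.single ⟨(1, 0), by simp⟩ a + Finsupp.single ⟨(1, 1), by simp⟩ b
  have hμ : totalLength (primitiveChain r + μ)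
      = ∑ x ∈ primitiveBall r, pairNorm x + (a + b * √2) := by
    rw [totalLength_add, totalLength_add, totalLength_single, totalLength_single,
      totalLength_primitiveChain]
    norm_num [pairNorm]
  calc (primitiveBall r).card = (primitiveChain r).support.card :=
        (card_primitiveChain_support r).symm
    _ ≤ (primitiveChain r + μ).support.card := by
        refine card_le_card fun x hx => ?_
        rw [Finsupp.mem_support_iff] at hx ⊢
        rw [Finsupp.add_apply]
        omega
    _ ≤ maxVerticesLen n δ := le_csSup (bddAbove_card_support n δ)
        ⟨_, by rw [hμ]; constructor <;> linarith, rfl⟩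

lemma tendsto_maxVerticesLen {δ : ℝ} (hδ : 0 < δ) {r : ℕ → ℝ} (hr : Tendsto r atTop atTop)
    (hrn : ∀ n, r n ^ 3 = π * n) :
    Tendsto (fun n => (maxVerticesLen n δ : ℝ) / r n ^ 2) atTop (𝓝 (3 / (2 * π))) := by
  have hpi := pi_pos
  have hinv : Tendsto (fun n => (r n)⁻¹ ^ 3) atTop (𝓝 0) := by
    simpa using (tendsto_inv_atTop_zero.comp hr).pow 3
  rw [tendsto_order]
  constructor
  · intro a ha
    obtain ⟨s, hs0, hs1, hsa⟩ : ∃ s : ℝ, 0 < s ∧ s < 1 ∧ a < s ^ 2 * (3 / (2 * π)) := by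
      have hc : Tendsto (fun s : ℝ => s ^ 2 * (3 / (2 * π))) (𝓝[<] 1) (𝓝 (3 / (2 * π))) := by
        have : ContinuousAt (fun s : ℝ => s ^ 2 * (3 / (2 * π))) 1 := by fun_prop
        simpa using this.tendsto.mono_left nhdsWithin_le_nhds
      have h := (hc.eventually_const_lt ha).and (Ioo_mem_nhdsLT (zero_lt_one (α := ℝ)))
      obtain ⟨s, h1, h2⟩ := h.exists
      exact ⟨s, h2.1, h2.2, h1⟩
    obtain ⟨C, hC⟩ := card_primitiveBall_le_maxVerticesLen hδ
    have hsr : Tendsto (fun n => s * r n) atTop atTop := hr.const_mul_atTop hs0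
    have hN : Tendsto (fun n => ((primitiveBall (s * r n)).card : ℝ) / r n ^ 2) atTop
        (𝓝 (s ^ 2 * (3 / (2 * π)))) := by
      refine ((tendsto_card_primitiveBall.comp hsr).const_mul (s ^ 2)).congr fun n => ?_
      simp only [Function.comp]
      field_simp
    have hL : Tendsto (fun n => ((∑ x ∈ primitiveBall (s * r n), pairNorm x) + C) / r n ^ 3) atTop
        (𝓝 (s ^ 3 * (1 / π))) := by
      have := ((tendsto_sum_pairNorm_primitiveBall.comp hsr).const_mul (s ^ 3)).add
        (hinv.const_mul C)
      rw [mul_zero, add_zero] at this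
      refine this.congr fun n => ?_
      simp only [Function.comp]
      field_simp
    have hlt : s ^ 3 * (1 / π) < 1 / π :=
      mul_lt_of_lt_one_left (by positivity) (pow_lt_one₀ hs0.le hs1 (by norm_num))
    filter_upwards [hN.eventually_const_lt hsa, hL.eventually_lt_const hlt,
      hr.eventually_gt_atTop 0] with n h1 h2 h3
    refine h1.trans_le ?_
    gcongr
    apply hC
    rw [div_lt_iff₀ (by positivity), hrn] at h2
    calc _ ≤ 1 / π * (π * n) := h2.le
      _ = n := by field_simp
  · intro a ha
    have hU : Tendsto (fun n => (n + δ + primitiveDeficit (r n)) / r n ^ 3) atTop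
        (𝓝 (3 / (2 * π))) := by
      have h := ((tendsto_primitiveDeficit.comp hr).add (hinv.const_mul δ)).const_add (1 / π)
      rw [mul_zero, add_zero, show 1 / π + 1 / (2 * π) = 3 / (2 * π) by field_simp; norm_num] at h
      refine h.congr' ?_
      filter_upwards [hr.eventually_gt_atTop 0] with n hn
      have : (n : ℝ) = r n ^ 3 / π := by rw [hrn]; field_simp
      rw [this]
      simp only [Function.comp]
      field_simp
      ring
    filter_upwards [hU.eventually_lt_const ha, hr.eventually_gt_atTop 0] with n h1 h2
    refine lt_of_le_of_lt ?_ h1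
    calc _ ≤ (n + δ + primitiveDeficit (r n)) / r n / r n ^ 2 := by
          gcongr
          exact maxVerticesLen_le n hδ.le h2
      _ = _ := by field_simp

end

/-- The maximal number of vertices of an element of `Π̃_{n,n+δ}` is asymptotically
equivalent to `(3/(2π^{1/3}))·n^{2/3}`. -/
theorem statement13 (δ : ℝ) (hδ : 0 < δ) :
    (fun n : ℕ => (maxVerticesLen n δ : ℝ))
      ~[atTop] (fun n : ℕ => 3 / (2 * π ^ ((1:ℝ)/3)) * (n : ℝ) ^ ((2:ℝ)/3)) := by
  have hpi := pi_pos
  set r : ℕ → ℝ := fun n => (π * n) ^ ((1 : ℝ) / 3) with hr_def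
  have hr : Tendsto r atTop atTop := (tendsto_rpow_atTop (by norm_num)).comp
    (tendsto_natCast_atTop_atTop.const_mul_atTop hpi)
  have hrn : ∀ n, r n ^ 3 = π * n := by
    intro n
    rw [hr_def, ← rpow_natCast, ← rpow_mul (by positivity)]
    norm_num
  have hval : ∀ n : ℕ, 3 / (2 * π ^ ((1:ℝ)/3)) * (n : ℝ) ^ ((2:ℝ)/3)
      = 3 / (2 * π) * r n ^ 2 := by
    intro n
    have h1 : r n ^ 2 = π ^ ((2 : ℝ) / 3) * (n : ℝ) ^ ((2 : ℝ) / 3) := by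
      rw [hr_def, ← rpow_natCast, ← rpow_mul (by positivity), mul_rpow hpi.le (Nat.cast_nonneg n)]
      norm_num
    have h2 : π ^ ((2 : ℝ) / 3) * π ^ ((1 : ℝ) / 3) = π := by
      rw [← rpow_add hpi]
      norm_num
    have h3 : 0 < π ^ ((1 : ℝ) / 3) := by positivity
    rw [h1]
    field_simp
    linear_combination -((n : ℝ) ^ ((2 : ℝ) / 3)) * h2
  simp_rw [hval]
  refine isEquivalent_of_tendsto_one ?_
  have h := (tendsto_maxVerticesLen hδ hr hrn).div_const (3 / (2 * π))
  rw [div_self (by positivity)] at h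
  refine h.congr fun n => ?_
  simp only [Pi.div_apply]
  rw [div_div, mul_comm]
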